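/- Let (M, e, Λ) with Λ < 0 be sub-extremal Reissner–Nordström–AdS parameters with largest horizon radius r_+, let α ∈ (−9/4, 0), Δ := √(9/4+α), q₀ ∈ ℝ. There exist C > 0, ε₀ > 0 and δ₀ > 0 such that for every ε ∈ (0, ε₀), every δ ∈ (0, δ₀) and every C² function f on (r_+, ∞) with ‖f‖_X ≤ δ, the solution (κ, Ω², ϖ, Q, A) of the auxiliary system (equations (i)–(v) with φ replaced by f) with horizon data at mass M and charge e satisfies, for all r ∈ (r_+, ∞): κ(r_+) ≤ κ(r) ≤ κ(r_+) + C(‖f‖_X² + ε²), |κ(r_+) − 1| ≤ Cε², |ϖ(r) − M| ≤ C(‖f‖_X² + ε²), |Q(r) − e| ≤ C(‖f‖_X² + ε²), |A(r) − A_RN(r)| ≤ C(‖f‖_X² + ε²), and |A(r)·r²/(Ω²κ⁻²)(r) − A_RN(r)·r²/Ω_RN²(r)| ≤ C(‖f‖_X² + ε²), where A_RN(r) = e(1/r_+ − 1/r) and Ω_RN²(r) = 1 − 2M/r + e²/r² + (−Λ/3)r². -/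

import Mathlib

open Real Set Filter

noncomputable section

/-- The Reissner–Nordström–AdS potential `Ω_RN²(r) = 1 − 2M/r + e²/r² + (−Λ/3)r²`. -/
noncomputable def RNpot (Λ M e r : ℝ) : ℝ := 1 - 2*M/r + e^2/r^2 + (-Λ/3)*r^2

/-- `(M, e, Λ)` are sub-extremal parameters with largest horizon radius `rp`. -/
def IsSubExtremal (Λ M e rp : ℝ) : Prop :=
  0 < rp ∧ RNpot Λ M e rp = 0 ∧
  (∃ r0, 0 < r0 ∧ r0 ≠ rp ∧ RNpot Λ M e r0 = 0) ∧
  ∀ r, 0 < r → RNpot Λ M e r = 0 → r ≤ rp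

/-- The auxiliary (fixed-point) system: equations (i)–(v) of the static
Einstein–Maxwell–(charged) Klein–Gordon system on `(r_+, ∞)`, with the scalar field
replaced by the given source `f`, for the unknowns `(κ, Ω², ϖ, Q, A)`. -/
def AuxSystem (Λ α q0 rp : ℝ) (f κ Ω2 ϖ Q A : ℝ → ℝ) : Prop :=
  ContDiffOn ℝ 1 κ (Set.Ioi rp) ∧ ContDiffOn ℝ 1 Ω2 (Set.Ioi rp) ∧
  ContDiffOn ℝ 1 ϖ (Set.Ioi rp) ∧ ContDiffOn ℝ 1 Q (Set.Ioi rp) ∧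
  ContDiffOn ℝ 1 A (Set.Ioi rp) ∧
  (∀ r ∈ Set.Ioi rp, 0 < κ r) ∧ (∀ r ∈ Set.Ioi rp, 0 < Ω2 r) ∧
  -- (i)
  (∀ r ∈ Set.Ioi rp, deriv κ r / κ r =
      r*(deriv f r)^2 + q0^2*r*(κ r)^2*(A r/Ω2 r)^2*(f r)^2) ∧
  -- (ii)
  (∀ r ∈ Set.Ioi rp, Ω2 r/(κ r)^2 = 1 - 2*ϖ r/r + (Q r)^2/r^2 + (-Λ/3)*r^2) ∧
  -- (iii)
  (∀ r ∈ Set.Ioi rp, deriv ϖ r =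
      (-Λ/3)*α*r^2*(f r)^2/2 + (r^2*(deriv f r)^2/2)*(Ω2 r/(κ r)^2)
      + q0^2*(A r)^2*r^2*(f r)^2/(2*Ω2 r)
      + q0^2*(Q r)*r*(A r/Ω2 r)*(κ r)*(f r)^2) ∧
  -- (iv)
  (∀ r ∈ Set.Ioi rp, deriv Q r = q0^2*r^2*(κ r)*(A r/Ω2 r)*(f r)^2) ∧
  -- (v)
  (∀ r ∈ Set.Ioi rp, deriv A r = Q r * κ r / r^2)

/-- The horizon data for the auxiliary system at `r = r_+` with mass `M`, charge `e`
and perturbation parameter `ε`, attained as limits from `(r_+, ∞)`. -/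
def AuxHorizon (Λ α rp M e ε : ℝ) (κ Ω2 ϖ Q A : ℝ → ℝ) : Prop :=
  ∃ Kp κp : ℝ,
    Kp = M/rp^2 - e^2/rp^3 + (-Λ/3)*rp ∧ 0 < Kp ∧
    κp = (1 - (-Λ/3)*α*rp*ε^2/(2*Kp))⁻¹ ∧
    Filter.Tendsto ϖ (nhdsWithin rp (Set.Ioi rp)) (nhds M) ∧
    Filter.Tendsto Q (nhdsWithin rp (Set.Ioi rp)) (nhds e) ∧
    Filter.Tendsto κ (nhdsWithin rp (Set.Ioi rp)) (nhds κp) ∧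
    Filter.Tendsto (fun r => A r / Ω2 r) (nhdsWithin rp (Set.Ioi rp))
      (nhds (e/(2*Kp*rp^2))) ∧
    Filter.Tendsto (deriv Ω2) (nhdsWithin rp (Set.Ioi rp)) (nhds (2*Kp*κp))

/-- `‖f‖_X ≤ δ`, where `‖f‖_X = sup |r^{3/2+Δ} f| + sup |r^{5/2+Δ} f'| +
sup |r^{3/2+Δ} W f''|` over `(r_+, ∞)` and `W` is the reference potential. -/
def XnormLE (rp Δ : ℝ) (W : ℝ → ℝ) (f : ℝ → ℝ) (δ : ℝ) : Prop :=
  ∃ d1 d2 d3 : ℝ, 0 ≤ d1 ∧ 0 ≤ d2 ∧ 0 ≤ d3 ∧ d1 + d2 + d3 ≤ δ ∧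
    (∀ r ∈ Set.Ioi rp, |r ^ ((3:ℝ)/2 + Δ) * f r| ≤ d1) ∧
    (∀ r ∈ Set.Ioi rp, |r ^ ((5:ℝ)/2 + Δ) * deriv f r| ≤ d2) ∧
    (∀ r ∈ Set.Ioi rp, |r ^ ((3:ℝ)/2 + Δ) * W r * deriv (deriv f) r| ≤ d3)

open Topology

/-- Open continuation principle on `(a, ∞)`: a property that holds near `a`, is open, and holds at
`r` as soon as it holds on `(a, r)`, holds everywhere. -/
lemma forall_gt_of_continuation {a : ℝ} {P : ℝ → Prop}
    (hstart : ∀ᶠ t in 𝓝[>] a, P t)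
    (hopen : ∀ r, a < r → P r → ∀ᶠ t in 𝓝 r, P t)
    (hstep : ∀ r, a < r → (∀ t ∈ Ioo a r, P t) → P r) :
    ∀ r, a < r → P r := by
  by_contra! hcon
  obtain ⟨x, hax, hx⟩ := hcon
  set T : Set ℝ := {t | a < t ∧ ¬ P t} with hT
  have hne : T.Nonempty := ⟨x, hax, hx⟩
  have hbdd : BddBelow T := ⟨a, fun t ht => ht.1.le⟩
  obtain ⟨u, hau, hu⟩ := (mem_nhdsGT_iff_exists_Ioo_subset).1 hstart
  have hau' : a < u := hau
  have hlt : a < sInf T := by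
    refine lt_of_lt_of_le hau' (le_csInf hne fun t ht => ?_)
    by_contra! htu
    exact ht.2 (hu ⟨ht.1, htu⟩)
  have hP : P (sInf T) := by
    refine hstep _ hlt fun t ht => ?_
    by_contra hPt
    exact absurd (csInf_le hbdd ⟨ht.1, hPt⟩) (not_le.2 ht.2)
  obtain ⟨v, hv, hvP⟩ := Metric.eventually_nhds_iff.1 (hopen _ hlt hP)
  obtain ⟨t, ht, htv⟩ := exists_lt_of_csInf_lt hne (lt_add_of_pos_right (sInf T) hv)
  have hle := csInf_le hbdd ht
  refine ht.2 (hvP ?_)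
  rw [Real.dist_eq, abs_lt]
  constructor <;> linarith

/-- A function with nonnegative derivative on `(a, r)` is at least its right limit at `a`. -/
lemma le_of_deriv_nonneg_of_tendsto {F : ℝ → ℝ} {a r F₀ : ℝ} (har : a < r)
    (hd : ∀ t, a < t → DifferentiableAt ℝ F t) (h0 : ∀ t ∈ Ioo a r, 0 ≤ deriv F t)
    (hlim : Tendsto F (𝓝[>] a) (𝓝 F₀)) : F₀ ≤ F r := by
  have hmono : MonotoneOn F (Ioc a r) := by
    refine monotoneOn_of_deriv_nonneg (convex_Ioc a r)
      (fun t ht => (hd t ht.1).continuousAt.continuousWithinAt) ?_ ?_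
    · intro t ht
      rw [interior_Ioc] at ht
      exact (hd t ht.1).differentiableWithinAt
    · intro t ht
      rw [interior_Ioc] at ht
      exact h0 t ht
  refine le_of_tendsto hlim ?_
  filter_upwards [Ioc_mem_nhdsGT har] with t ht
  exact hmono ht ⟨har, le_rfl⟩ ht.2

/-- A function whose derivative is dominated by `H'` on `(a, r)` moves at most as much as `H`. -/
lemma abs_sub_le_of_abs_deriv_le {X H h : ℝ → ℝ} {a r X₀ : ℝ} (har : a < r)
    (hX : ∀ t, a < t → DifferentiableAt ℝ X t) (hH : ∀ t, a ≤ t → HasDerivAt H (h t) t)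
    (hle : ∀ t ∈ Ioo a r, |deriv X t| ≤ h t)
    (hlim : Tendsto X (𝓝[>] a) (𝓝 X₀)) : |X r - X₀| ≤ H r - H a := by
  have hHlim : Tendsto H (𝓝[>] a) (𝓝 (H a)) :=
    (hH a le_rfl).continuousAt.tendsto.mono_left nhdsWithin_le_nhds
  have h1 : H a - X₀ ≤ H r - X r := by
    refine le_of_deriv_nonneg_of_tendsto (F := fun t => H t - X t) har
      (fun t ht => (hH t ht.le).differentiableAt.sub (hX t ht)) (fun t ht => ?_)
      (hHlim.sub hlim)
    rw [((hH t ht.1.le).fun_sub (hX t ht.1).hasDerivAt).deriv]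
    linarith [(abs_le.1 (hle t ht)).2]
  have h2 : H a + X₀ ≤ H r + X r := by
    refine le_of_deriv_nonneg_of_tendsto (F := fun t => H t + X t) har
      (fun t ht => (hH t ht.le).differentiableAt.add (hX t ht)) (fun t ht => ?_)
      (hHlim.add hlim)
    rw [((hH t ht.1.le).fun_add (hX t ht.1).hasDerivAt).deriv]
    linarith [(abs_le.1 (hle t ht)).1]
  rw [abs_le]
  constructor <;> linarith

/-- Linear bound for functions with bounded derivative. -/
lemma abs_sub_le_mul_sub {X : ℝ → ℝ} {a r X₀ b : ℝ} (har : a < r)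
    (hX : ∀ t, a < t → DifferentiableAt ℝ X t) (hle : ∀ t ∈ Ioo a r, |deriv X t| ≤ b)
    (hlim : Tendsto X (𝓝[>] a) (𝓝 X₀)) : |X r - X₀| ≤ b * (r - a) := by
  have := abs_sub_le_of_abs_deriv_le (H := fun t => b * t) (h := fun _ => b) har hX
    (fun t _ => by simpa using (hasDerivAt_id t).const_mul b) hle hlim
  linarith

/-- Uniform bound for functions whose derivative decays like `t ^ (-1 - 2Δ)`. -/
lemma abs_sub_le_of_deriv_rpow {X : ℝ → ℝ} {a r X₀ b Δ : ℝ} (ha : 0 < a) (hb : 0 ≤ b)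
    (hΔ : 0 < Δ) (har : a < r)
    (hX : ∀ t, a < t → DifferentiableAt ℝ X t)
    (hle : ∀ t ∈ Ioo a r, |deriv X t| ≤ b * t ^ (-1 - 2 * Δ))
    (hlim : Tendsto X (𝓝[>] a) (𝓝 X₀)) : |X r - X₀| ≤ b * (a ^ (-2 * Δ) / (2 * Δ)) := by
  have := abs_sub_le_of_abs_deriv_le (H := fun t => -(b / (2 * Δ)) * t ^ (-2 * Δ))
    (h := fun t => b * t ^ (-1 - 2 * Δ)) har hX
    (fun t ht => by
      have h := (Real.hasDerivAt_rpow_const (x := t) (p := -2 * Δ)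
        (Or.inl (ha.trans_le ht).ne')).const_mul (-(b / (2 * Δ)))
      refine h.congr_deriv ?_
      rw [show -2 * Δ - 1 = -1 - 2 * Δ by ring]
      field_simp) hle hlim
  have hr : 0 ≤ (b / (2 * Δ)) * r ^ (-2 * Δ) := by
    have := ha.trans har
    positivity
  have e : b * (a ^ (-2 * Δ) / (2 * Δ)) = (b / (2 * Δ)) * a ^ (-2 * Δ) := by ring
  rw [e]
  linarith

/-- Bound for functions whose derivative decays like `t ^ (-2)`. -/
lemma abs_sub_le_of_deriv_inv_sq {X : ℝ → ℝ} {a r X₀ b : ℝ} (ha : 0 < a) (har : a < r)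
    (hX : ∀ t, a < t → DifferentiableAt ℝ X t)
    (hle : ∀ t ∈ Ioo a r, |deriv X t| ≤ b / t ^ 2)
    (hlim : Tendsto X (𝓝[>] a) (𝓝 X₀)) : |X r - X₀| ≤ b * (1 / a - 1 / r) := by
  have := abs_sub_le_of_abs_deriv_le (H := fun t => -b * t⁻¹)
    (h := fun t => b / t ^ 2) har hX
    (fun t ht => by
      have h := (hasDerivAt_inv (ha.trans_le ht).ne').const_mul (-b)
      refine h.congr_deriv ?_
      field_simp) hle hlim
  rw [one_div, one_div]
  linarith

/-- Surface gravity `K_+` of the horizon `r = rp`. -/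
def surfGrav (Λ M e rp : ℝ) : ℝ := M/rp^2 - e^2/rp^3 + (-Λ/3)*rp

/-- The potential grows at least like `(r - rp) r` outside a nondegenerate horizon. -/
lemma exists_mul_le_RNpot {Λ M e rp : ℝ} (hΛ : Λ < 0) (hrp : 0 < rp)
    (h0 : RNpot Λ M e rp = 0) (hK : 0 < surfGrav Λ M e rp) :
    ∃ c > 0, ∀ r, rp < r → c * ((r - rp) * r) ≤ RNpot Λ M e r := by
  obtain ⟨L, hL⟩ : ∃ L, L = -Λ / 3 := ⟨_, rfl⟩
  have hL0 : 0 < L := by rw [hL]; linarith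
  unfold RNpot at *
  unfold surfGrav at hK
  rw [← hL] at h0 hK ⊢
  have hM : 2 * M = rp + e ^ 2 / rp + L * rp ^ 3 := by
    field_simp at h0 ⊢
    linarith
  set p := rp - e ^ 2 / rp + 3 * L * rp ^ 3 with hp
  have hppos : 0 < p := by
    have : p = 2 * rp ^ 2 * (M / rp ^ 2 - e ^ 2 / rp ^ 3 + L * rp) := by
      rw [hp, show M = (rp + e ^ 2 / rp + L * rp ^ 3) / 2 by linarith]
      field_simp
      ring
    rw [this]
    positivity
  refine ⟨min L (p / rp ^ 3), lt_min hL0 (by positivity), fun r hr => ?_⟩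
  have hr0 : 0 < r := hrp.trans hr
  set c := min L (p / rp ^ 3)
  have hcL : c ≤ L := min_le_left _ _
  have hcp : c * rp ^ 3 ≤ p := (le_div_iff₀ (by positivity)).1 (min_le_right _ _)
  have hfac : 1 - 2 * M / r + e ^ 2 / r ^ 2 + L * r ^ 2
      = (r - rp) * (L * r ^ 3 + L * rp * r ^ 2 + (1 + L * rp ^ 2) * r - e ^ 2 / rp) / r ^ 2 := by
    rw [hM]
    field_simp
    ring
  rw [hfac, le_div_iff₀ (by positivity)]
  have hcube : rp ^ 3 ≤ r ^ 3 := by gcongr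
  have hsq : rp * rp ^ 2 ≤ rp * r ^ 2 := by gcongr
  have hsq' : L * (rp * rp ^ 2) ≤ L * (rp * r ^ 2) := by gcongr
  have hlin : (1 + L * rp ^ 2) * rp ≤ (1 + L * rp ^ 2) * r := by gcongr
  have hcl : 0 ≤ (L - c) * (r ^ 3 - rp ^ 3) :=
    mul_nonneg (by linarith) (by linarith)
  have key : c * r ^ 3 ≤ L * r ^ 3 + L * rp * r ^ 2 + (1 + L * rp ^ 2) * r - e ^ 2 / rp := by
    nlinarith
  calc c * ((r - rp) * r) * r ^ 2 = (r - rp) * (c * r ^ 3) := by ring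
    _ ≤ _ := mul_le_mul_of_nonneg_left key (by linarith)

lemma XnormLE.nonneg {rp Δ s : ℝ} {W f : ℝ → ℝ} (h : XnormLE rp Δ W f s) : 0 ≤ s := by
  obtain ⟨d1, d2, d3, h1, h2, h3, h, -⟩ := h
  linarith

lemma sq_mul_le_of_abs_rpow_mul_le {r p q y s : ℝ} {n : ℕ} (hr : 0 < r)
    (hpq : 2 * p + q = n) (h : |r ^ p * y| ≤ s) :
    r ^ n * y ^ 2 ≤ s ^ 2 * r ^ q := by
  have hrn : (r : ℝ) ^ n = (r ^ p) ^ 2 * r ^ q := by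
    rw [← Real.rpow_natCast r n, ← hpq, Real.rpow_add hr, two_mul, Real.rpow_add hr, sq]
  have h2 : (r ^ p * y) ^ 2 ≤ s ^ 2 := sq_le_sq.2 (h.trans (le_abs_self s))
  calc r ^ n * y ^ 2 = (r ^ p * y) ^ 2 * r ^ q := by rw [hrn]; ring
    _ ≤ s ^ 2 * r ^ q := by gcongr

lemma XnormLE.sq_bounds {rp Δ s : ℝ} {W f : ℝ → ℝ} (hrp : 0 < rp) (h : XnormLE rp Δ W f s)
    {r : ℝ} (hr : rp < r) :
    r ^ 2 * f r ^ 2 ≤ s ^ 2 * r ^ (-1 - 2 * Δ) ∧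
    r ^ 4 * deriv f r ^ 2 ≤ s ^ 2 * r ^ (-1 - 2 * Δ) := by
  obtain ⟨d1, d2, d3, h1, h2, h3, h, hf, hf', -⟩ := h
  have hr0 := hrp.trans hr
  exact ⟨sq_mul_le_of_abs_rpow_mul_le hr0 (by push_cast; ring)
      ((hf r hr).trans (by linarith)),
    sq_mul_le_of_abs_rpow_mul_le hr0 (by push_cast; ring)
      ((hf' r hr).trans (by linarith))⟩

/-- Pointwise bound on the right-hand side of the equation for `κ'`. -/
lemma kappa_rhs_le {rp t x x' k y N q σ : ℝ} (hrp : 0 < rp) (ht : rp ≤ t)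
    (hk0 : 0 ≤ k) (hk : k ≤ 2) (hy : |y| * t ^ 2 ≤ N)
    (hx : t ^ 2 * x ^ 2 ≤ σ) (hx' : t ^ 4 * x' ^ 2 ≤ σ) :
    k * (t * x' ^ 2 + q ^ 2 * t * k ^ 2 * y ^ 2 * x ^ 2)
      ≤ 2 * (1 / rp ^ 3 + 4 * q ^ 2 * N ^ 2 / rp ^ 5) * σ := by
  have ht0 : 0 < t := hrp.trans_le ht
  have hσ : 0 ≤ σ := le_trans (by positivity) hx
  have e1 : t * x' ^ 2 = (1 / t ^ 3) * (t ^ 4 * x' ^ 2) := by field_simp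
  have e2 : q ^ 2 * t * k ^ 2 * y ^ 2 * x ^ 2
      = q ^ 2 * k ^ 2 * (|y| * t ^ 2) ^ 2 * (t ^ 2 * x ^ 2) / t ^ 5 := by
    rw [mul_pow, sq_abs]; field_simp
  have b1 : t * x' ^ 2 ≤ 1 / rp ^ 3 * σ := by rw [e1]; gcongr
  have b2 : q ^ 2 * t * k ^ 2 * y ^ 2 * x ^ 2 ≤ q ^ 2 * 2 ^ 2 * N ^ 2 * σ / rp ^ 5 := by
    rw [e2]; gcongr
  calc k * (t * x' ^ 2 + q ^ 2 * t * k ^ 2 * y ^ 2 * x ^ 2)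
      ≤ 2 * (1 / rp ^ 3 * σ + q ^ 2 * 2 ^ 2 * N ^ 2 * σ / rp ^ 5) := by gcongr
    _ = _ := by ring

/-- Pointwise bound on the right-hand side of the equation for `Q'`. -/
lemma charge_rhs_le {rp t x k y N q σ : ℝ} (hrp : 0 < rp) (ht : rp ≤ t) (hN : 0 ≤ N)
    (hk0 : 0 ≤ k) (hk : k ≤ 2) (hy : |y| * t ^ 2 ≤ N) (hx : t ^ 2 * x ^ 2 ≤ σ) :
    |q ^ 2 * t ^ 2 * k * y * x ^ 2| ≤ 2 * q ^ 2 * N / rp ^ 2 * σ := by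
  have ht0 : 0 < t := hrp.trans_le ht
  have hσ : 0 ≤ σ := le_trans (by positivity) hx
  have e : |q ^ 2 * t ^ 2 * k * y * x ^ 2|
      = q ^ 2 * k * (|y| * t ^ 2) * (t ^ 2 * x ^ 2) / t ^ 2 := by
    rw [abs_mul, abs_mul, abs_of_nonneg (by positivity : 0 ≤ q ^ 2 * t ^ 2 * k),
      abs_of_nonneg (sq_nonneg x)]
    field_simp
  rw [e]
  calc q ^ 2 * k * (|y| * t ^ 2) * (t ^ 2 * x ^ 2) / t ^ 2
      ≤ q ^ 2 * 2 * N * σ / rp ^ 2 := by gcongr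
    _ = _ := by ring

/-- Pointwise bound on the right-hand side of the equation for `ϖ'`. -/
lemma mass_rhs_le {rp t x x' k y N q σ L α w W Q E : ℝ} (hrp : 0 < rp) (ht : rp ≤ t)
    (hN : 0 ≤ N) (hL : 0 ≤ L) (hk0 : 0 ≤ k) (hk : k ≤ 2) (hy : |y| * t ^ 2 ≤ N)
    (hw0 : 0 ≤ w) (hw : w ≤ W * t ^ 2) (hQ : |Q| ≤ E)
    (hx : t ^ 2 * x ^ 2 ≤ σ) (hx' : t ^ 4 * x' ^ 2 ≤ σ) :
    |L * α * t ^ 2 * x ^ 2 / 2 + t ^ 2 * x' ^ 2 / 2 * w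
        + q ^ 2 * (y ^ 2 * (w * k ^ 2)) * t ^ 2 * x ^ 2 / 2 + q ^ 2 * Q * t * y * k * x ^ 2|
      ≤ (L * |α| / 2 + W / 2 + 2 * q ^ 2 * N ^ 2 * W / rp ^ 2 + 2 * q ^ 2 * E * N / rp ^ 3) * σ := by
  have ht0 : 0 < t := hrp.trans_le ht
  have hσ : 0 ≤ σ := le_trans (by positivity) hx
  have hE : 0 ≤ E := (abs_nonneg _).trans hQ
  have hW : 0 ≤ W := by
    by_contra! hW
    nlinarith [mul_neg_of_neg_of_pos hW (by positivity : 0 < t ^ 2)]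
  have b1 : |L * α * t ^ 2 * x ^ 2 / 2| ≤ L * |α| * σ / 2 := by
    have e : |L * α * t ^ 2 * x ^ 2 / 2| = L * |α| * (t ^ 2 * x ^ 2) / 2 := by
      rw [abs_div, abs_mul, abs_mul, abs_mul, abs_of_nonneg hL, abs_of_nonneg (sq_nonneg x),
        abs_of_nonneg (sq_nonneg t), abs_two, mul_assoc (L * |α|)]
    rw [e]; gcongr
  have b2 : |t ^ 2 * x' ^ 2 / 2 * w| ≤ W * σ / 2 := by
    rw [abs_of_nonneg (by positivity)]
    calc t ^ 2 * x' ^ 2 / 2 * w ≤ t ^ 2 * x' ^ 2 / 2 * (W * t ^ 2) := by gcongr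
      _ = W * (t ^ 4 * x' ^ 2) / 2 := by ring
      _ ≤ _ := by gcongr
  have b3 : |q ^ 2 * (y ^ 2 * (w * k ^ 2)) * t ^ 2 * x ^ 2 / 2|
      ≤ q ^ 2 * N ^ 2 * W * 2 ^ 2 * σ / rp ^ 2 / 2 := by
    rw [abs_of_nonneg (by positivity)]
    calc q ^ 2 * (y ^ 2 * (w * k ^ 2)) * t ^ 2 * x ^ 2 / 2
        ≤ q ^ 2 * (y ^ 2 * ((W * t ^ 2) * k ^ 2)) * t ^ 2 * x ^ 2 / 2 := by gcongr
      _ = q ^ 2 * (|y| * t ^ 2) ^ 2 * W * k ^ 2 * (t ^ 2 * x ^ 2) / t ^ 2 / 2 := by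
        rw [mul_pow, sq_abs]; field_simp
      _ ≤ _ := by gcongr
  have b4 : |q ^ 2 * Q * t * y * k * x ^ 2| ≤ q ^ 2 * E * N * 2 * σ / rp ^ 3 := by
    have e : |q ^ 2 * Q * t * y * k * x ^ 2|
        = q ^ 2 * |Q| * (|y| * t ^ 2) * k * (t ^ 2 * x ^ 2) / t ^ 3 := by
      simp only [abs_mul, abs_of_nonneg hk0, abs_of_nonneg ht0.le, abs_of_nonneg (sq_nonneg x),
        abs_of_nonneg (sq_nonneg q)]
      field_simp
    rw [e]; gcongr
  refine (abs_add_le _ _).trans ?_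
  have h3 := abs_add_three (L * α * t ^ 2 * x ^ 2 / 2) (t ^ 2 * x' ^ 2 / 2 * w)
    (q ^ 2 * (y ^ 2 * (w * k ^ 2)) * t ^ 2 * x ^ 2 / 2)
  refine (add_le_add (h3.trans (add_le_add_three b1 b2 b3)) b4).trans (le_of_eq ?_)
  ring

lemma abs_potential_sub_le {L M e m Q r rp d : ℝ} (hrp : 0 < rp) (hr : rp ≤ r) (hd : 0 ≤ d)
    (hm : |m - M| ≤ d) (hQ : |Q - e| ≤ d) (hQ1 : |Q - e| ≤ 1) :
    |(1 - 2*m/r + Q^2/r^2 + L*r^2) - (1 - 2*M/r + e^2/r^2 + L*r^2)|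
      ≤ (2 / rp + (2 * |e| + 1) / rp ^ 2) * d := by
  have hr0 := hrp.trans_le hr
  have e1 : (1 - 2*m/r + Q^2/r^2 + L*r^2) - (1 - 2*M/r + e^2/r^2 + L*r^2)
      = -(2 * (m - M) / r) + (2 * e + (Q - e)) * (Q - e) / r ^ 2 := by ring
  have b1 : |-(2 * (m - M) / r)| ≤ 2 * d / rp := by
    rw [abs_neg, abs_div, abs_mul, abs_two, abs_of_pos hr0]
    gcongr
  have b2 : |(2 * e + (Q - e)) * (Q - e) / r ^ 2| ≤ (2 * |e| + 1) * d / rp ^ 2 := by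
    rw [abs_div, abs_mul, abs_of_pos (by positivity : 0 < r ^ 2)]
    have : |2 * e + (Q - e)| ≤ 2 * |e| + 1 := by
      refine (abs_add_le _ _).trans ?_
      rw [abs_mul, abs_two]
      gcongr
    gcongr
  rw [e1]
  refine (abs_add_le _ _).trans ((add_le_add b1 b2).trans (le_of_eq ?_))
  ring

lemma potential_le {L M e m Q r rp : ℝ} (hrp : 0 < rp) (hr : rp ≤ r)
    (hm : |m - M| ≤ 1) (hQ : |Q| ≤ |e| + 1) :
    1 - 2*m/r + Q^2/r^2 + L*r^2
      ≤ (1 / rp ^ 2 + 2 * (|M| + 1) / rp ^ 3 + (|e| + 1) ^ 2 / rp ^ 4 + L) * r ^ 2 := by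
  have hr0 := hrp.trans_le hr
  have hm' : -m ≤ |M| + 1 := by
    linarith [(abs_le.1 hm).1, neg_abs_le M]
  have h1 : 1 ≤ 1 / rp ^ 2 * r ^ 2 := by
    rw [div_mul_eq_mul_div, one_mul, le_div_iff₀ (by positivity), one_mul]
    gcongr
  have h2 : -(2 * m / r) ≤ 2 * (|M| + 1) / rp ^ 3 * r ^ 2 := by
    have : -(2 * m / r) = 2 * (-m) / r ^ 3 * r ^ 2 := by field_simp
    rw [this]
    gcongr
  have h3 : Q ^ 2 / r ^ 2 ≤ (|e| + 1) ^ 2 / rp ^ 4 * r ^ 2 := by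
    have : Q ^ 2 / r ^ 2 = |Q| ^ 2 / r ^ 4 * r ^ 2 := by rw [sq_abs]; field_simp
    rw [this]
    gcongr
  linarith

/-- Comparison of the two quotients `A / w` given comparisons of numerators and potentials. -/
lemma abs_quotient_sub_le {A e r rp w R c K₁ K₂ : ℝ} (hrp : 0 < rp) (hr : rp < r) (hc : 0 < c)
    (hK₁ : 0 ≤ K₁) (hK₂ : 0 ≤ K₂)
    (hw : c / 2 * ((r - rp) * r) ≤ w) (hR : c * ((r - rp) * r) ≤ R)
    (hA : |A - e * (1 / rp - 1 / r)| ≤ K₁ * (1 / rp - 1 / r))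
    (hwR : |w - R| ≤ K₂ * (r - rp)) :
    |A * r ^ 2 / w - e * (1 / rp - 1 / r) * r ^ 2 / R|
      ≤ 2 / (c * rp) * K₁ + 2 * |e| / (c ^ 2 * rp ^ 2) * K₂ := by
  have hr0 := hrp.trans hr
  have hx : 0 < r - rp := by linarith
  have hD : 1 / rp - 1 / r = (r - rp) / (rp * r) := by field_simp
  rw [hD] at hA ⊢
  have hw0 : 0 < w := lt_of_lt_of_le (by positivity) hw
  have hR0 : 0 < R := lt_of_lt_of_le (by positivity) hR
  have e1 : A * r ^ 2 / w - e * ((r - rp) / (rp * r)) * r ^ 2 / R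
      = (A - e * ((r - rp) / (rp * r))) * r ^ 2 / w
        - e * ((r - rp) / (rp * r)) * r ^ 2 * (w - R) / (w * R) := by
    field_simp
    ring
  have b1 : |(A - e * ((r - rp) / (rp * r))) * r ^ 2 / w| ≤ 2 / (c * rp) * K₁ := by
    rw [abs_div, abs_mul, abs_of_pos hw0, abs_of_pos (by positivity : 0 < r ^ 2)]
    calc _ ≤ K₁ * ((r - rp) / (rp * r)) * r ^ 2 / (c / 2 * ((r - rp) * r)) := by gcongr
      _ = _ := by field_simp
  have b2 : |e * ((r - rp) / (rp * r)) * r ^ 2 * (w - R) / (w * R)|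
      ≤ 2 * |e| / (c ^ 2 * rp ^ 2) * K₂ := by
    rw [abs_div, abs_mul, abs_mul, abs_mul, abs_of_pos (mul_pos hw0 hR0),
      abs_of_pos (by positivity : 0 < r ^ 2), abs_of_pos (by positivity : 0 < (r - rp) / (rp * r))]
    calc _ ≤ |e| * ((r - rp) / (rp * r)) * r ^ 2 * (K₂ * (r - rp))
          / ((c / 2 * ((r - rp) * r)) * (c * ((r - rp) * r))) := by gcongr
      _ = 2 * |e| / (c ^ 2 * rp * r) * K₂ := by field_simp
      _ ≤ 2 * |e| / (c ^ 2 * rp * rp) * K₂ := by gcongr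
      _ = _ := by ring
  rw [e1]
  exact (abs_sub _ _).trans (add_le_add b1 b2)

/-- Growth constant for `κ`, `Q` and `ϖ` under the a priori bound `|A / Ω²| r² ≤ N`. -/
def rateConst (Λ α q rp M e N : ℝ) : ℝ :=
  2 * (1 / rp ^ 3 + 4 * q ^ 2 * N ^ 2 / rp ^ 5) + 2 * q ^ 2 * N / rp ^ 2
  + ((-Λ/3) * |α| / 2
    + (1 / rp ^ 2 + 2 * (|M| + 1) / rp ^ 3 + (|e| + 1) ^ 2 / rp ^ 4 + (-Λ/3)) / 2
    + 2 * q ^ 2 * N ^ 2 * (1 / rp ^ 2 + 2 * (|M| + 1) / rp ^ 3 + (|e| + 1) ^ 2 / rp ^ 4 + (-Λ/3))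
      / rp ^ 2
    + 2 * q ^ 2 * (|e| + 1) * N / rp ^ 3)

/-- The a priori bounds propagated by the continuation argument. -/
def AprioriBound (M e N : ℝ) (κ Ω2 ϖ Q A : ℝ → ℝ) (t : ℝ) : Prop :=
  |A t / Ω2 t| * t ^ 2 < N ∧ κ t < 2 ∧ |Q t - e| < 1 ∧ |ϖ t - M| < 1

section Estimates

variable {Λ M e rp α Δ q0 s N κp : ℝ} {W f κ Ω2 ϖ Q A : ℝ → ℝ}

lemma abs_le_add_one_of_sub_lt {x y : ℝ} (h : |x - y| < 1) : |x| ≤ |y| + 1 := by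
  have := abs_sub_abs_le_abs_sub x y
  linarith

lemma rateConst_nonneg (hΛ : Λ < 0) (hrp : 0 < rp) (hN : 0 ≤ N) :
    0 ≤ rateConst Λ α q0 rp M e N := by
  have hL : 0 ≤ -Λ / 3 := by linarith
  unfold rateConst
  positivity

lemma AuxSystem.deriv_bounds (hΛ : Λ < 0) (hrp : 0 < rp) (hN : 0 ≤ N)
    (hsys : AuxSystem Λ α q0 rp f κ Ω2 ϖ Q A) (hf : XnormLE rp Δ W f s)
    {t : ℝ} (ht : rp < t) (hap : AprioriBound M e N κ Ω2 ϖ Q A t) :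
    |deriv κ t| ≤ rateConst Λ α q0 rp M e N * s ^ 2 * t ^ (-1 - 2 * Δ) ∧
    |deriv Q t| ≤ rateConst Λ α q0 rp M e N * s ^ 2 * t ^ (-1 - 2 * Δ) ∧
    |deriv ϖ t| ≤ rateConst Λ α q0 rp M e N * s ^ 2 * t ^ (-1 - 2 * Δ) := by
  obtain ⟨-, -, -, -, -, hκ0, hΩ0, h1, h2, h3, h4, -⟩ := hsys
  obtain ⟨hy, hk, hQ, hm⟩ := hap
  obtain ⟨hx, hx'⟩ := hf.sq_bounds hrp ht
  have ht0 : 0 < t := hrp.trans ht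
  have hk0 := hκ0 t ht
  have hO0 := hΩ0 t ht
  have hL : 0 ≤ -Λ / 3 := by linarith
  have hQ' := abs_le_add_one_of_sub_lt hQ
  have hw := (h2 t ht).le.trans (potential_le (L := -Λ/3) hrp ht.le hm.le hQ')
  have bκ := kappa_rhs_le (q := q0) hrp ht.le hk0.le hk.le hy.le hx hx'
  have bQ := charge_rhs_le (q := q0) hrp ht.le hN hk0.le hk.le hy.le hx
  have bm := mass_rhs_le (q := q0) (α := α) hrp ht.le hN hL hk0.le hk.le hy.le
    (by positivity : 0 ≤ Ω2 t / κ t ^ 2) hw hQ' hx hx'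
  have eκ : deriv κ t = κ t * (t * deriv f t ^ 2
      + q0 ^ 2 * t * κ t ^ 2 * (A t / Ω2 t) ^ 2 * f t ^ 2) := by
    rw [← h1 t ht]; field_simp
  have eQ : deriv Q t = q0 ^ 2 * t ^ 2 * κ t * (A t / Ω2 t) * f t ^ 2 := h4 t ht
  have em : deriv ϖ t = (-Λ/3) * α * t ^ 2 * f t ^ 2 / 2 + t ^ 2 * deriv f t ^ 2 / 2 * (Ω2 t / κ t ^ 2)
      + q0 ^ 2 * ((A t / Ω2 t) ^ 2 * (Ω2 t / κ t ^ 2 * κ t ^ 2)) * t ^ 2 * f t ^ 2 / 2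
      + q0 ^ 2 * Q t * t * (A t / Ω2 t) * κ t * f t ^ 2 := by
    rw [h3 t ht]
    congr 2
    field_simp
  have hs : 0 ≤ s ^ 2 * t ^ (-1 - 2 * Δ) := le_trans (by positivity) hx
  rw [eκ, eQ, em, mul_assoc (rateConst _ _ _ _ _ _ _)]
  rw [abs_of_nonneg (by positivity : 0 ≤ κ t * (t * deriv f t ^ 2
      + q0 ^ 2 * t * κ t ^ 2 * (A t / Ω2 t) ^ 2 * f t ^ 2))]
  unfold rateConst
  refine ⟨bκ.trans (mul_le_mul_of_nonneg_right ?_ hs), bQ.trans (mul_le_mul_of_nonneg_right ?_ hs),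
    bm.trans (mul_le_mul_of_nonneg_right ?_ hs)⟩
  · rw [add_assoc]
    exact le_add_of_nonneg_right (by positivity)
  · rw [add_right_comm]
    exact le_add_of_nonneg_left (by positivity)
  · exact le_add_of_nonneg_left (by positivity)

lemma differentiableAt_of_contDiffOn_Ioi {X : ℝ → ℝ} (h : ContDiffOn ℝ 1 X (Ioi rp)) :
    ∀ t, rp < t → DifferentiableAt ℝ X t := fun _ ht =>
  (h.differentiableOn one_ne_zero).differentiableAt (Ioi_mem_nhds ht)

lemma AuxSystem.le_kappa (hrp : 0 < rp) (hsys : AuxSystem Λ α q0 rp f κ Ω2 ϖ Q A)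
    (hlim : Tendsto κ (𝓝[>] rp) (𝓝 κp)) {r : ℝ} (hr : rp < r) : κp ≤ κ r := by
  obtain ⟨hκ, -, -, -, -, hκ0, -, h1, -⟩ := hsys
  refine le_of_deriv_nonneg_of_tendsto hr (differentiableAt_of_contDiffOn_Ioi hκ)
    (fun t ht => ?_) hlim
  have hk0 := hκ0 t ht.1
  have ht0 : 0 < t := hrp.trans ht.1
  have : 0 ≤ deriv κ t / κ t := by rw [h1 t ht.1]; positivity
  rw [div_nonneg_iff] at this
  rcases this with h | h
  · exact h.1
  · linarith [h.2]

lemma AuxSystem.increments (hΛ : Λ < 0) (hrp : 0 < rp) (hN : 0 ≤ N) (hΔ : 0 < Δ)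
    (hsys : AuxSystem Λ α q0 rp f κ Ω2 ϖ Q A) (hf : XnormLE rp Δ W f s)
    (hlκ : Tendsto κ (𝓝[>] rp) (𝓝 κp)) (hlQ : Tendsto Q (𝓝[>] rp) (𝓝 e))
    (hlm : Tendsto ϖ (𝓝[>] rp) (𝓝 M)) {r : ℝ} (hr : rp < r)
    (hap : ∀ t ∈ Ioo rp r, AprioriBound M e N κ Ω2 ϖ Q A t) :
    |κ r - κp| ≤ rateConst Λ α q0 rp M e N * (rp ^ (-2 * Δ) / (2 * Δ)) * s ^ 2 ∧
    |Q r - e| ≤ rateConst Λ α q0 rp M e N * (rp ^ (-2 * Δ) / (2 * Δ)) * s ^ 2 ∧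
    |ϖ r - M| ≤ rateConst Λ α q0 rp M e N * (rp ^ (-2 * Δ) / (2 * Δ)) * s ^ 2 ∧
    |Q r - e| ≤ rateConst Λ α q0 rp M e N * rp ^ (-1 - 2 * Δ) * s ^ 2 * (r - rp) ∧
    |ϖ r - M| ≤ rateConst Λ α q0 rp M e N * rp ^ (-1 - 2 * Δ) * s ^ 2 * (r - rp) := by
  have hK : 0 ≤ rateConst Λ α q0 rp M e N := rateConst_nonneg hΛ hrp hN
  have hd := fun t (ht : t ∈ Ioo rp r) => hsys.deriv_bounds hΛ hrp hN hf ht.1 (hap t ht)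
  obtain ⟨hκ, -, hm, hQ, -⟩ := hsys
  replace hκ := differentiableAt_of_contDiffOn_Ioi hκ
  replace hm := differentiableAt_of_contDiffOn_Ioi hm
  replace hQ := differentiableAt_of_contDiffOn_Ioi hQ
  generalize rateConst Λ α q0 rp M e N = K at *
  have hKs : 0 ≤ K * s ^ 2 := by positivity
  have hdec : ∀ t ∈ Ioo rp r, K * s ^ 2 * t ^ (-1 - 2 * Δ) ≤ K * s ^ 2 * rp ^ (-1 - 2 * Δ) :=
    fun t ht => mul_le_mul_of_nonneg_left
      (Real.rpow_le_rpow_of_nonpos hrp ht.1.le (by linarith)) hKs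
  rw [mul_right_comm K, mul_right_comm K (rp ^ (-1 - 2 * Δ))]
  exact ⟨abs_sub_le_of_deriv_rpow hrp hKs hΔ hr hκ (fun t ht => (hd t ht).1) hlκ,
    abs_sub_le_of_deriv_rpow hrp hKs hΔ hr hQ (fun t ht => (hd t ht).2.1) hlQ,
    abs_sub_le_of_deriv_rpow hrp hKs hΔ hr hm (fun t ht => (hd t ht).2.2) hlm,
    abs_sub_le_mul_sub hr hQ (fun t ht => (hd t ht).2.1.trans (hdec t ht)) hlQ,
    abs_sub_le_mul_sub hr hm (fun t ht => (hd t ht).2.2.trans (hdec t ht)) hlm⟩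

lemma AuxSystem.tendsto_potential (hrp : 0 < rp) (hsys : AuxSystem Λ α q0 rp f κ Ω2 ϖ Q A)
    (h0 : RNpot Λ M e rp = 0) (hlκ : Tendsto κ (𝓝[>] rp) (𝓝 κp))
    (hlQ : Tendsto Q (𝓝[>] rp) (𝓝 e)) (hlm : Tendsto ϖ (𝓝[>] rp) (𝓝 M)) :
    Tendsto Ω2 (𝓝[>] rp) (𝓝 0) := by
  obtain ⟨-, -, -, -, -, hκ0, -, -, h2, -⟩ := hsys
  have hid : Tendsto (fun r : ℝ => r) (𝓝[>] rp) (𝓝 rp) := tendsto_id.mono_left nhdsWithin_le_nhds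
  have hlim : Tendsto (fun r => (1 - 2 * ϖ r / r + Q r ^ 2 / r ^ 2 + (-Λ/3) * r ^ 2) * κ r ^ 2)
      (𝓝[>] rp) (𝓝 (RNpot Λ M e rp * κp ^ 2)) := by
    unfold RNpot
    refine Tendsto.mul (Tendsto.add (Tendsto.add (Tendsto.sub tendsto_const_nhds
      ((hlm.const_mul 2).div hid hrp.ne')) ((hlQ.pow 2).div (hid.pow 2) (by positivity)))
      ((hid.pow 2).const_mul _)) (hlκ.pow 2)
  rw [h0, zero_mul] at hlim
  refine hlim.congr' ?_
  filter_upwards [self_mem_nhdsWithin] with r hr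
  have := hκ0 r hr
  rw [← h2 r hr]
  field_simp

/-- Gain in the continuation argument: closeness to the reference potential and the bound on
`A / Ω²`. -/
lemma AuxSystem.potential_bounds {c d : ℝ} (hrp : 0 < rp) (hc : 0 < c)
    (hsys : AuxSystem Λ α q0 rp f κ Ω2 ϖ Q A) (hκp : 1 / 2 ≤ κp)
    (hlκ : Tendsto κ (𝓝[>] rp) (𝓝 κp)) (hlA : Tendsto A (𝓝[>] rp) (𝓝 0))
    {r : ℝ} (hr : rp < r) (hd : 0 ≤ d)
    (hRN : c * ((r - rp) * r) ≤ RNpot Λ M e r)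
    (hap : ∀ t ∈ Ioo rp r, AprioriBound M e N κ Ω2 ϖ Q A t)
    (hQ1 : |Q r - e| ≤ 1) (hQ : |Q r - e| ≤ d * (r - rp)) (hm : |ϖ r - M| ≤ d * (r - rp))
    (hsmall : (2 / rp + (2 * |e| + 1) / rp ^ 2) * d ≤ c * rp / 2) :
    |Ω2 r / κ r ^ 2 - RNpot Λ M e r| ≤ (2 / rp + (2 * |e| + 1) / rp ^ 2) * d * (r - rp) ∧
    c / 2 * ((r - rp) * r) ≤ Ω2 r / κ r ^ 2 ∧
    |A r / Ω2 r| * r ^ 2 ≤ 16 * (|e| + 1) / (c * rp) := by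
  have hr0 : 0 < r := hrp.trans hr
  have hx : 0 < r - rp := by linarith
  have hκ2 : 1 / 2 ≤ κ r := hκp.trans (hsys.le_kappa hrp hlκ hr)
  obtain ⟨-, -, -, -, hA, hκ0, hΩ0, -, h2, -, -, h5⟩ := hsys
  have hO0 : 0 < Ω2 r := hΩ0 r hr
  have hcl : |Ω2 r / κ r ^ 2 - RNpot Λ M e r|
      ≤ (2 / rp + (2 * |e| + 1) / rp ^ 2) * d * (r - rp) := by
    rw [h2 r hr, mul_assoc]
    exact abs_potential_sub_le hrp hr.le (by positivity) hm hQ hQ1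
  have hlow : c / 2 * ((r - rp) * r) ≤ Ω2 r / κ r ^ 2 := by
    have h1 : (2 / rp + (2 * |e| + 1) / rp ^ 2) * d * (r - rp) ≤ c * r / 2 * (r - rp) := by
      refine mul_le_mul_of_nonneg_right (hsmall.trans ?_) hx.le
      gcongr
    linarith [(abs_le.1 hcl).1]
  refine ⟨hcl, hlow, ?_⟩
  have hAb : |A r| ≤ (2 * (|e| + 1)) * (1 / rp - 1 / r) := by
    have := abs_sub_le_of_deriv_inv_sq (b := 2 * (|e| + 1)) hrp hr
      (differentiableAt_of_contDiffOn_Ioi hA) (fun t ht => ?_) hlA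
    · simpa using this
    · obtain ⟨-, hk, hQ, -⟩ := hap t ht
      have ht0 : 0 < t := hrp.trans ht.1
      rw [h5 t ht.1, abs_div, abs_mul, abs_of_pos (hκ0 t ht.1), abs_of_pos (by positivity : 0 < t ^ 2),
        mul_comm 2]
      have := abs_le_add_one_of_sub_lt hQ
      have := hκ0 t ht.1
      gcongr
  have hΩ : c / 8 * ((r - rp) * r) ≤ Ω2 r := by
    have h4 : (1 / 2) ^ 2 ≤ κ r ^ 2 := by gcongr
    rw [le_div_iff₀ (by positivity)] at hlow
    have : c / 2 * ((r - rp) * r) * (1 / 2) ^ 2 ≤ c / 2 * ((r - rp) * r) * κ r ^ 2 := by gcongr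
    linarith
  rw [abs_div, abs_of_pos hO0]
  have hAb0 := (abs_nonneg _).trans hAb
  calc |A r| / Ω2 r * r ^ 2
      ≤ (2 * (|e| + 1)) * (1 / rp - 1 / r) / (c / 8 * ((r - rp) * r)) * r ^ 2 := by gcongr
    _ = (2 * (|e| + 1)) * ((r - rp) / (rp * r)) / (c / 8 * ((r - rp) * r)) * r ^ 2 := by
      congr 3; field_simp
    _ = 16 * (|e| + 1) / (c * rp) := by field_simp; norm_num

lemma abs_gauge_sub_le {B : ℝ} (hrp : 0 < rp) (hsys : AuxSystem Λ α q0 rp f κ Ω2 ϖ Q A)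
    (hlA : Tendsto A (𝓝[>] rp) (𝓝 0)) (hQκ : ∀ t, rp < t → |Q t * κ t - e| ≤ B)
    {r : ℝ} (hr : rp < r) : |A r - e * (1 / rp - 1 / r)| ≤ B * (1 / rp - 1 / r) := by
  obtain ⟨-, -, -, -, hA, -, -, -, -, -, -, h5⟩ := hsys
  have hdA := differentiableAt_of_contDiffOn_Ioi hA
  have hD : ∀ t, rp ≤ t → HasDerivAt (fun u => e * (1 / rp - u⁻¹)) (e / t ^ 2) t := fun t ht => by
    have ht0 : 0 < t := hrp.trans_le ht
    refine (((hasDerivAt_inv ht0.ne').const_sub (1 / rp)).const_mul e).congr_deriv ?_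
    field_simp
  have hDlim : Tendsto (fun u => e * (1 / rp - u⁻¹)) (𝓝[>] rp) (𝓝 0) := by
    have := (hD rp le_rfl).continuousAt.tendsto.mono_left (nhdsWithin_le_nhds (s := Ioi rp))
    simpa using this
  have key := abs_sub_le_of_deriv_inv_sq (X := fun u => A u - e * (1 / rp - u⁻¹)) (X₀ := 0)
    (b := B) hrp hr (fun t ht => (hdA t ht).sub (hD t ht.le).differentiableAt) (fun t ht => ?_)
    (by simpa using hlA.sub hDlim)
  · simpa using key
  · have ht0 : 0 < t := hrp.trans ht.1
    rw [((hdA t ht.1).hasDerivAt.fun_sub (hD t ht.1.le)).deriv, h5 t ht.1, ← sub_div, abs_div,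
      abs_of_pos (by positivity : 0 < t ^ 2)]
    have := hQκ t ht.1
    gcongr

end Estimates

lemma mul_sq_lt_one {b x : ℝ} (hb : 0 ≤ b) (hx : 0 ≤ x) (h : x < 1 / (1 + b)) :
    b * x ^ 2 < 1 := by
  have h1 : x * (1 + b) < 1 := (lt_div_iff₀ (by positivity)).1 h
  have h2 : x ≤ 1 := by nlinarith
  nlinarith [mul_nonneg hb hx]

/-- The inverse lapse at the horizon is close to one. -/
lemma inv_one_add_bounds {b ε : ℝ} (hb : 0 ≤ b) (hε : 0 < ε) (hε1 : ε < 1 / (1 + b)) :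
    1 / 2 ≤ (1 + b * ε ^ 2)⁻¹ ∧ (1 + b * ε ^ 2)⁻¹ ≤ 1 ∧ |(1 + b * ε ^ 2)⁻¹ - 1| ≤ b * ε ^ 2 := by
  have hbε : b * ε ^ 2 ≤ 1 := (mul_sq_lt_one hb hε.le hε1).le
  have hp : 0 < 1 + b * ε ^ 2 := by positivity
  refine ⟨?_, inv_le_one_of_one_le₀ (by linarith [mul_nonneg hb (sq_nonneg ε)]), ?_⟩
  · rw [one_div]
    exact inv_anti₀ hp (by linarith)
  · have e : (1 + b * ε ^ 2)⁻¹ - 1 = -(b * ε ^ 2 * (1 + b * ε ^ 2)⁻¹) := by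
      field_simp
      ring
    rw [e, abs_neg, abs_of_nonneg (by positivity)]
    exact mul_le_of_le_one_right (by positivity)
      (inv_le_one_of_one_le₀ (by linarith [mul_nonneg hb (sq_nonneg ε)]))

/-- The a priori bounds hold on the whole exterior when the source is small. -/
lemma AuxSystem.aprioriBound {Λ M e rp α Δ q0 s N κp y₀ c : ℝ} {W f κ Ω2 ϖ Q A : ℝ → ℝ}
    (hΛ : Λ < 0) (hrp : 0 < rp) (hΔ : 0 < Δ) (hc : 0 < c)
    (hsys : AuxSystem Λ α q0 rp f κ Ω2 ϖ Q A) (hf : XnormLE rp Δ W f s)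
    (hRN : ∀ r, rp < r → c * ((r - rp) * r) ≤ RNpot Λ M e r)
    (hκp : 1 / 2 ≤ κp) (hκp1 : κp ≤ 1)
    (hlκ : Tendsto κ (𝓝[>] rp) (𝓝 κp)) (hlQ : Tendsto Q (𝓝[>] rp) (𝓝 e))
    (hlm : Tendsto ϖ (𝓝[>] rp) (𝓝 M)) (hlA : Tendsto A (𝓝[>] rp) (𝓝 0))
    (hly : Tendsto (fun r => A r / Ω2 r) (𝓝[>] rp) (𝓝 y₀))
    (hN : 16 * (|e| + 1) / (c * rp) < N) (hy₀ : |y₀| * rp ^ 2 < N)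
    (hs1 : rateConst Λ α q0 rp M e N * (rp ^ (-2 * Δ) / (2 * Δ)) * s ^ 2 < 1)
    (hs2 : (2 / rp + (2 * |e| + 1) / rp ^ 2)
      * (rateConst Λ α q0 rp M e N * rp ^ (-1 - 2 * Δ) * s ^ 2) ≤ c * rp / 2) :
    ∀ r, rp < r → AprioriBound M e N κ Ω2 ϖ Q A r := by
  have hN0 : 0 ≤ N := le_trans (by positivity) hN.le
  refine forall_gt_of_continuation ?_ ?_ ?_
  · have hid : Tendsto (fun r : ℝ => r) (𝓝[>] rp) (𝓝 rp) :=
      tendsto_id.mono_left nhdsWithin_le_nhds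
    filter_upwards [(hly.abs.mul (hid.pow 2)).eventually_lt_const hy₀,
      hlκ.eventually_lt_const (by linarith : κp < 2),
      (hlQ.sub_const e).abs.eventually_lt_const (by simp : |e - e| < 1),
      (hlm.sub_const M).abs.eventually_lt_const (by simp : |M - M| < 1)] with t h1 h2 h3 h4
    exact ⟨h1, h2, h3, h4⟩
  · intro r hr ⟨h1, h2, h3, h4⟩
    obtain ⟨cκ, cΩ, cm, cQ, cA, -, hΩ0, -⟩ := hsys
    have dκ := (differentiableAt_of_contDiffOn_Ioi cκ r hr).continuousAt
    have dΩ := (differentiableAt_of_contDiffOn_Ioi cΩ r hr).continuousAt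
    have dm := (differentiableAt_of_contDiffOn_Ioi cm r hr).continuousAt
    have dQ := (differentiableAt_of_contDiffOn_Ioi cQ r hr).continuousAt
    have dA := (differentiableAt_of_contDiffOn_Ioi cA r hr).continuousAt
    filter_upwards [((dA.div dΩ (hΩ0 r hr).ne').abs.mul (continuousAt_id.pow 2)).eventually_lt_const h1,
      dκ.eventually_lt_const h2, (dQ.sub continuousAt_const).abs.eventually_lt_const h3,
      (dm.sub continuousAt_const).abs.eventually_lt_const h4] with t g1 g2 g3 g4
    exact ⟨g1, g2, g3, g4⟩
  · intro r hr hap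
    have hK : 0 ≤ rateConst Λ α q0 rp M e N := rateConst_nonneg hΛ hrp hN0
    obtain ⟨iκ, iQ, im, iQ', im'⟩ := hsys.increments hΛ hrp hN0 hΔ hf hlκ hlQ hlm hr hap
    have hpot := hsys.potential_bounds hrp hc hκp hlκ hlA hr (by positivity) (hRN r hr) hap
      (iQ.trans hs1.le) iQ' im' hs2
    refine ⟨hpot.2.2.trans_lt hN, ?_, iQ.trans_lt hs1, im.trans_lt hs1⟩
    linarith [(abs_le.1 iκ).2]

set_option maxHeartbeats 1000000 in
theorem stmt_14 (Λ M e rp α Δ q0 : ℝ) (hΛ : Λ < 0)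
    (hsub : IsSubExtremal Λ M e rp)
    (hα : α ∈ Ioo (-(9:ℝ)/4) 0) (hΔ : Δ = Real.sqrt (9/4 + α)) :
    ∃ C > (0:ℝ), ∃ ε₀ > (0:ℝ), ∃ δ₀ > (0:ℝ),
      ∀ ε δ : ℝ, 0 < ε → ε < ε₀ → 0 < δ → δ < δ₀ →
      ∀ f κ Ω2 ϖ Q A : ℝ → ℝ,
        ContDiffOn ℝ 2 f (Ioi rp) →
        XnormLE rp Δ (RNpot Λ M e) f δ →
        AuxSystem Λ α q0 rp f κ Ω2 ϖ Q A →
        AuxHorizon Λ α rp M e ε κ Ω2 ϖ Q A →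
        -- with ‖f‖_X ≤ η for any η (in particular η = ‖f‖_X), the estimates hold:
        ∀ η : ℝ, XnormLE rp Δ (RNpot Λ M e) f η →
          |(1 - (-Λ/3)*α*rp*ε^2/(2*(M/rp^2 - e^2/rp^3 + (-Λ/3)*rp)))⁻¹ - 1|
            ≤ C*ε^2 ∧
          ∀ r ∈ Ioi rp,
            (1 - (-Λ/3)*α*rp*ε^2/(2*(M/rp^2 - e^2/rp^3 + (-Λ/3)*rp)))⁻¹ ≤ κ r ∧
            κ r ≤ (1 - (-Λ/3)*α*rp*ε^2/(2*(M/rp^2 - e^2/rp^3 + (-Λ/3)*rp)))⁻¹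
              + C*(η^2 + ε^2) ∧
            |ϖ r - M| ≤ C*(η^2 + ε^2) ∧
            |Q r - e| ≤ C*(η^2 + ε^2) ∧
            |A r - e*(1/rp - 1/r)| ≤ C*(η^2 + ε^2) ∧
            |A r * r^2 / (Ω2 r/(κ r)^2)
              - e*(1/rp - 1/r) * r^2 / RNpot Λ M e r| ≤ C*(η^2 + ε^2) := by
  obtain ⟨hrp, h0, -⟩ := hsub
  have hΔ0 : 0 < Δ := by
    rw [hΔ]
    exact Real.sqrt_pos.2 (by linarith [hα.1])
  have hα0 : α < 0 := hα.2
  by_cases hK : 0 < surfGrav Λ M e rp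
  swap
  · refine ⟨1, one_pos, 1, one_pos, 1, one_pos, ?_⟩
    rintro ε δ - - - - f κ Ω2 ϖ Q A - - - ⟨Kp, κp, hKp, hKp0, -⟩
    exact absurd (hKp0.trans_eq hKp) hK
  obtain ⟨c, hc, hRN⟩ := exists_mul_le_RNpot hΛ hrp h0 hK
  have hKeq : M/rp^2 - e^2/rp^3 + (-Λ/3)*rp = surfGrav Λ M e rp := rfl
  rw [hKeq]
  set Kp := surfGrav Λ M e rp
  obtain ⟨b, hb⟩ : ∃ b, b = (-Λ/3) * (-α) * rp / (2 * Kp) := ⟨_, rfl⟩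
  have hb0 : 0 ≤ b := by
    have : 0 ≤ -Λ / 3 := by linarith
    have : 0 ≤ -α := by linarith
    rw [hb]; positivity
  have hκform : ∀ ε : ℝ, (1 - (-Λ/3)*α*rp*ε^2/(2*Kp))⁻¹ = (1 + b * ε ^ 2)⁻¹ := by
    intro ε
    rw [hb]; congr 1; ring
  obtain ⟨N, hN⟩ : ∃ N, N = 16 * (|e| + 1) / (c * rp) + |e| / (2 * Kp) + 1 := ⟨_, rfl⟩
  have hN1 : 16 * (|e| + 1) / (c * rp) < N := by
    have : 0 ≤ |e| / (2 * Kp) := by positivity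
    rw [hN]; linarith
  have hN2 : |e| / (2 * Kp) < N := by
    have : 0 ≤ 16 * (|e| + 1) / (c * rp) := by positivity
    rw [hN]; linarith
  have hN0 : 0 ≤ N := le_trans (by positivity) hN2.le
  have hRC : 0 ≤ rateConst Λ α q0 rp M e N := rateConst_nonneg hΛ hrp hN0
  obtain ⟨G, hG⟩ : ∃ G, G = rateConst Λ α q0 rp M e N * (rp ^ (-2 * Δ) / (2 * Δ)) := ⟨_, rfl⟩
  obtain ⟨D, hD⟩ : ∃ D, D = rateConst Λ α q0 rp M e N * rp ^ (-1 - 2 * Δ) := ⟨_, rfl⟩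
  obtain ⟨V, hV⟩ : ∃ V, V = 2 / rp + (2 * |e| + 1) / rp ^ 2 := ⟨_, rfl⟩
  have hG0 : 0 ≤ G := by rw [hG]; positivity
  have hD0 : 0 ≤ D := by rw [hD]; positivity
  have hV0 : 0 ≤ V := by rw [hV]; positivity
  obtain ⟨Y, hY⟩ : ∃ Y, Y = G + V * D * (2 / (c * rp)) := ⟨_, rfl⟩
  have hY0 : 0 ≤ Y := by rw [hY]; positivity
  obtain ⟨B, hB⟩ : ∃ B, B = 2 * G + |e| * (G + b) := ⟨_, rfl⟩
  have hB0 : 0 ≤ B := by rw [hB]; positivity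
  obtain ⟨T, hT⟩ : ∃ T, T = 2 / (c * rp) * B + 2 * |e| / (c ^ 2 * rp ^ 2) * (V * D) := ⟨_, rfl⟩
  have hT0 : 0 ≤ T := by rw [hT]; positivity
  have hBrp : 0 ≤ B / rp := by positivity
  refine ⟨b + G + B / rp + T + 1, by positivity, 1 / (1 + b), by positivity,
    1 / (1 + Y), by positivity, ?_⟩
  intro ε δ hε hε1 hδ hδ1 f κ Ω2 ϖ Q A _ hfδ hsys hhor η hfη
  rw [hκform]
  obtain ⟨Kp', κp, hKp, -, hκp, hlm, hlQ, hlκ, hly, -⟩ := hhor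
  rw [hKeq] at hKp
  rw [hKp] at hκp hly
  rw [hκform] at hκp
  rw [← hκp]
  obtain ⟨hκh, hκ1, hκb⟩ := inv_one_add_bounds hb0 hε hε1
  rw [← hκp] at hκh hκ1 hκb
  obtain ⟨s, hs, hsδ, hsη⟩ : ∃ s, XnormLE rp Δ (RNpot Λ M e) f s ∧ s ≤ δ ∧ s ≤ η := by
    rcases le_total δ η with h | h
    · exact ⟨δ, hfδ, le_rfl, h⟩
    · exact ⟨η, hfη, h, le_rfl⟩
  have hs0 := hs.nonneg
  have hs2η : s ^ 2 ≤ η ^ 2 := by gcongr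
  have hYs : Y * s ^ 2 < 1 := mul_sq_lt_one hY0 hs0 (hsδ.trans_lt hδ1)
  have hGs : G * s ^ 2 < 1 := by
    refine lt_of_le_of_lt ?_ hYs
    gcongr
    rw [hY]
    exact le_add_of_nonneg_right (by positivity)
  have hVs : V * (D * s ^ 2) ≤ c * rp / 2 := by
    have h1 : V * D * (2 / (c * rp)) * s ^ 2 ≤ 1 := by
      refine le_trans ?_ hYs.le
      gcongr
      rw [hY]
      exact le_add_of_nonneg_left hG0
    calc V * (D * s ^ 2) = (V * D * (2 / (c * rp)) * s ^ 2) * (c * rp / 2) := by field_simp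
      _ ≤ 1 * (c * rp / 2) := by gcongr
      _ = _ := one_mul _
  have hlA : Tendsto A (𝓝[>] rp) (𝓝 0) := by
    have h := hly.mul (hsys.tendsto_potential hrp h0 hlκ hlQ hlm)
    rw [mul_zero] at h
    refine h.congr' ?_
    filter_upwards [self_mem_nhdsWithin] with r hr
    exact div_mul_cancel₀ _ (hsys.2.2.2.2.2.2.1 r hr).ne'
  have hy₀ : |e / (2 * Kp * rp ^ 2)| * rp ^ 2 < N := by
    refine lt_of_eq_of_lt ?_ hN2
    rw [abs_div, abs_of_pos (by positivity : 0 < 2 * Kp * rp ^ 2)]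
    field_simp
  have hap := hsys.aprioriBound hΛ hrp hΔ0 hc hs hRN hκh hκ1 hlκ hlQ hlm hlA hly hN1 hy₀
    (by rw [← hG]; exact hGs) (by rw [← hD, ← hV]; exact hVs)
  have hinc := fun r (hr : rp < r) =>
    hsys.increments hΛ hrp hN0 hΔ0 hs hlκ hlQ hlm hr (fun t ht => hap t ht.1)
  rw [← hG, ← hD] at hinc
  obtain ⟨S, hS⟩ : ∃ S, S = η ^ 2 + ε ^ 2 := ⟨_, rfl⟩
  have hsS : s ^ 2 ≤ S := by rw [hS]; linarith [sq_nonneg ε]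
  have hεS : ε ^ 2 ≤ S := by rw [hS]; linarith [sq_nonneg η]
  have hS0 : 0 ≤ S := (sq_nonneg s).trans hsS
  rw [← hS]
  have hGS : G * s ^ 2 ≤ G * S := by gcongr
  have hCG : G * S ≤ (b + G + B / rp + T + 1) * S := by gcongr; linarith
  refine ⟨hκb.trans (by gcongr; linarith), fun r hr => ?_⟩
  have hr' : rp < r := hr
  have hr0 : 0 < r := hrp.trans hr'
  obtain ⟨iκ, iQ, im, iQ', im'⟩ := hinc r hr
  have hQκ : ∀ t, rp < t → |Q t * κ t - e| ≤ B * S := by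
    intro t ht
    obtain ⟨jκ, jQ, -⟩ := hinc t ht
    have hk0 := hsys.2.2.2.2.2.1 t ht
    have hk2 := (hap t ht).2.1
    have e1 : Q t * κ t - e = (Q t - e) * κ t + e * ((κ t - κp) + (κp - 1)) := by ring
    have b1 : |(Q t - e) * κ t| ≤ G * S * 2 := by
      rw [abs_mul, abs_of_pos hk0]
      have := jQ.trans hGS
      gcongr
    have b2 : |(κ t - κp) + (κp - 1)| ≤ G * S + b * S :=
      (abs_add_le _ _).trans (add_le_add (jκ.trans hGS) (hκb.trans (by gcongr)))
    have b3 : |e * ((κ t - κp) + (κp - 1))| ≤ |e| * (G * S + b * S) := by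
      rw [abs_mul]
      gcongr
    rw [e1, hB]
    refine (abs_add_le _ _).trans ((add_le_add b1 b3).trans (le_of_eq ?_))
    ring
  have hA := abs_gauge_sub_le hrp hsys hlA hQκ hr
  obtain ⟨hw1, hw2, -⟩ := hsys.potential_bounds hrp hc hκh hlκ hlA hr' (by positivity) (hRN r hr)
    (fun t ht => hap t ht.1) (iQ.trans hGs.le) iQ' im' (by rw [← hV]; exact hVs)
  rw [← hV] at hw1
  refine ⟨hsys.le_kappa hrp hlκ hr, ?_, im.trans (hGS.trans hCG), iQ.trans (hGS.trans hCG), ?_, ?_⟩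
  · linarith [(abs_le.1 iκ).2]
  · calc |A r - e * (1 / rp - 1 / r)| ≤ B * S * (1 / rp - 1 / r) := hA
      _ ≤ B * S * (1 / rp) := by
        gcongr
        linarith [one_div_pos.2 hr0]
      _ = (B / rp) * S := by ring
      _ ≤ _ := by gcongr; linarith
  · refine (abs_quotient_sub_le hrp hr' hc (mul_nonneg hB0 hS0) (by positivity) hw2 (hRN r hr) hA
      hw1).trans ?_
    calc 2 / (c * rp) * (B * S) + 2 * |e| / (c ^ 2 * rp ^ 2) * (V * (D * s ^ 2))
        ≤ 2 / (c * rp) * (B * S) + 2 * |e| / (c ^ 2 * rp ^ 2) * (V * (D * S)) := by gcongr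
      _ = T * S := by rw [hT]; ring
      _ ≤ _ := by gcongr; linarith
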